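/- For every integer m ≥ 2 and every integer n ≥ m + 1, there exist processing times p_1, …, p_n ∈ ℕ and, for each k ∈ {1, …, n−m}, deadlines d_1^{(k)} ≤ d_2^{(k)} ≤ … ≤ d_n^{(k)} in ℕ (so every instance orders the jobs by deadline in the same way), with all jobs released at time 0, such that: (i) for each k, the instance J_k consisting of the n jobs with windows [0, d_j^{(k)}] and processing times p_j admits a feasible preemptive schedule on m machines; and (ii) every preemptive schedule that processes each job j in exactly p_j slots t ≥ 0 and completes each job j by time min_k d_j^{(k)} (i.e., is simultaneously feasible for all instances J_k) has some slot in which at least n − 1 jobs are processed. -/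

import Mathlib

/-- A job with release date `r`, deadline `d`, and processing time `p`. -/
structure Job where
  r : ℕ
  d : ℕ
  p : ℕ

/-- A job is valid if `1 ≤ p` and `p ≤ d - r` (i.e. `r + p ≤ d`). -/
def Job.valid (j : Job) : Prop := 1 ≤ j.p ∧ j.r + j.p ≤ j.d

/-- The laxity `ℓ_j = d_j - r_j - p_j` of a job. -/
def Job.lax (j : Job) : ℕ := j.d - j.r - j.p

/-- A preemptive schedule of the instance `J` is feasible on `m` machines if at most `m`
jobs are processed in every slot, every job is only processed inside its window, and
every job is processed for exactly `p_j` slots. -/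
def FeasiblePre {n : ℕ} (J : Fin n → Job) (m : ℕ) : Prop :=
  ∃ S : ℕ → Finset (Fin n),
    (∀ t, (S t).card ≤ m) ∧
    (∀ t j, j ∈ S t → (J j).r ≤ t ∧ t < (J j).d) ∧
    (∀ j, ((Finset.range (J j).d).filter (fun t => j ∈ S t)).card = (J j).p)

/-- The minimum number of machines on which `J` admits a feasible preemptive schedule. -/
noncomputable def mOpt {n : ℕ} (J : Fin n → Job) : ℕ := sInf {m | FeasiblePre J m}

/-- Non-preemptive schedules, given by start times, are preemptive schedules. -/
lemma feasiblePre_of_starts {n : ℕ} (p d s : Fin n → ℕ) (m : ℕ) (hd : ∀ j, s j + p j ≤ d j)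
    (hm : ∀ t, (Finset.univ.filter fun j => s j ≤ t ∧ t < s j + p j).card ≤ m) :
    FeasiblePre (fun j => Job.mk 0 (d j) (p j)) m := by
  refine ⟨fun t => Finset.univ.filter fun j => s j ≤ t ∧ t < s j + p j, hm, ?_, ?_⟩
  · intro t j hj
    have := hd j
    simp only [Finset.mem_filter, Finset.mem_univ, true_and] at hj
    exact ⟨Nat.zero_le t, by dsimp only; omega⟩
  · intro j
    have h : (Finset.range (d j)).filter
        (fun t => j ∈ Finset.univ.filter fun j => s j ≤ t ∧ t < s j + p j)
        = Finset.Ico (s j) (s j + p j) := by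
      ext t
      have := hd j
      simp only [Finset.mem_filter, Finset.mem_univ, true_and, Finset.mem_range, Finset.mem_Ico]
      omega
    exact (congrArg Finset.card h).trans (by simp)

/-- The intervals `[2 ^ i - 1, 2 ^ (i + 1) - 1)` are pairwise disjoint. -/
lemma eq_of_mem_dyadic_intervals {i j t : ℕ} (hi : 2 ^ i - 1 ≤ t) (hi' : t < 2 ^ i - 1 + 2 ^ i)
    (hj : 2 ^ j - 1 ≤ t) (hj' : t < 2 ^ j - 1 + 2 ^ j) : i = j := by
  have key : ∀ a, 2 ^ a - 1 ≤ t → t < 2 ^ a - 1 + 2 ^ a → Nat.log 2 (t + 1) = a := by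
    intro a h h'
    have := Nat.one_le_two_pow (n := a)
    exact Nat.log_eq_of_pow_le_of_lt_pow (by omega) (by rw [pow_succ]; omega)
  rw [← key i hi hi', ← key j hj hj']

/-- Jobs of length `2 ^ j`, the first `m` of which have no laxity, fit on `m ≥ 1` machines. -/
lemma feasiblePre_initial_tight {n : ℕ} (m : ℕ) (hm : 1 ≤ m) :
    FeasiblePre (fun j : Fin n =>
      Job.mk 0 (if m ≤ (j : ℕ) then 2 ^ ((j : ℕ) + 1) else 2 ^ (j : ℕ)) (2 ^ (j : ℕ))) m := by
  refine feasiblePre_of_starts (fun j : Fin n => 2 ^ (j : ℕ)) _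
    (fun j => if m ≤ (j : ℕ) then 2 ^ (j : ℕ) - 1 else 0) m ?_ ?_
  · intro j
    split_ifs
    · rw [pow_succ]; omega
    · omega
  · intro t
    by_cases ht : t + 1 < 2 ^ m
    · calc _ ≤ (Finset.range m).card := by
            refine Finset.card_le_card_of_injOn Fin.val ?_ Fin.val_injective.injOn
            intro j hj
            simp only [Finset.coe_filter, Finset.mem_univ, true_and, Set.mem_ofPred_eq] at hj
            simp only [Finset.coe_range, Set.mem_Iio]
            by_contra! h
            have := Nat.pow_le_pow_right (show 0 < 2 by norm_num) h
            simp only [h, if_true] at hj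
            omega
        _ = m := Finset.card_range m
    · refine le_trans (Finset.card_le_one.2 ?_) hm
      have key : ∀ a : Fin n, (if m ≤ (a : ℕ) then 2 ^ (a : ℕ) - 1 else 0) ≤ t ∧
          t < (if m ≤ (a : ℕ) then 2 ^ (a : ℕ) - 1 else 0) + 2 ^ (a : ℕ) →
          2 ^ (a : ℕ) - 1 ≤ t ∧ t < 2 ^ (a : ℕ) - 1 + 2 ^ (a : ℕ) := by
        intro a ha
        split_ifs at ha with h
        · exact ha
        · have := Nat.pow_le_pow_right (show 0 < 2 by norm_num) (not_le.1 h).le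
          omega
      intro a ha b hb
      simp only [Finset.mem_filter, Finset.mem_univ, true_and] at ha hb
      have ha' := key a ha
      have hb' := key b hb
      exact Fin.ext (eq_of_mem_dyadic_intervals ha'.1 ha'.2 hb'.1 hb'.2)

/-- Jobs of length `2 ^ j`, where job `T` has no laxity and all earlier jobs share its deadline,
fit on two machines. -/
lemma feasiblePre_single_tight {n : ℕ} (T : Fin n) (m : ℕ) (hm : 2 ≤ m) :
    FeasiblePre (fun j : Fin n =>
      Job.mk 0 (if T < j then 2 ^ ((j : ℕ) + 1) else 2 ^ (T : ℕ)) (2 ^ (j : ℕ))) m := by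
  refine feasiblePre_of_starts (fun j : Fin n => 2 ^ (j : ℕ)) _
    (fun j => if j = T then 0 else 2 ^ (j : ℕ) - 1) m ?_ ?_
  · intro j
    split_ifs with h₁ h₂ h₂
    · exact absurd h₂ (h₁ ▸ lt_irrefl _)
    · simp [h₁]
    · rw [pow_succ]; omega
    · have hlt : (j : ℕ) + 1 ≤ T := by
        have := Fin.val_ne_of_ne h₁
        rw [Fin.lt_def] at h₂
        omega
      have := Nat.pow_le_pow_right (show 0 < 2 by norm_num) hlt
      rw [pow_succ] at this
      omega
  · intro t
    refine le_trans ?_ hm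
    refine le_trans (Nat.sub_le_iff_le_add.1 (Finset.pred_card_le_card_erase (a := T))) ?_
    refine Nat.succ_le_succ (Finset.card_le_one.2 ?_)
    intro a ha b hb
    simp only [Finset.mem_erase, Finset.mem_filter, Finset.mem_univ, true_and] at ha hb
    rw [if_neg ha.1] at ha
    rw [if_neg hb.1] at hb
    exact Fin.ext (eq_of_mem_dyadic_intervals ha.2.1 ha.2.2 hb.2.1 hb.2.2)

/-- For all `m ≥ 2` and `n ≥ m + 1` there are processing times
`p_1, …, p_n` and, for each `k ∈ {1, …, n-m}`, deadlines `d^{(k)}_1 ≤ … ≤ d^{(k)}_n`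
(all jobs released at time `0`) such that (i) every instance `J_k` (with windows
`[0, d^{(k)}_j]`) admits a feasible preemptive schedule on `m` machines, and (ii)
every preemptive schedule processing each job `j` for exactly `p_j` slots that is
simultaneously feasible for all the instances `J_k` (i.e. finishing each job `j`
before `min_k d^{(k)}_j`) uses at least `n - 1` machines in some slot. -/
theorem deadline_ordered_lower_bound (m n : ℕ) (hm : 2 ≤ m) (hn : m + 1 ≤ n) :
    ∃ (p : Fin n → ℕ) (d : Fin (n - m) → Fin n → ℕ),
      (∀ j, 1 ≤ p j) ∧
      (∀ k, Monotone (d k)) ∧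
      (∀ k j, p j ≤ d k j) ∧
      (∀ k, FeasiblePre (fun j => Job.mk 0 (d k j) (p j)) m) ∧
      (∀ S : ℕ → Finset (Fin n),
        (∀ j t, j ∈ S t → ∀ k, t < d k j) →
        (∀ j k, ((Finset.range (d k j)).filter (fun t => j ∈ S t)).card = p j) →
        ∃ t, n - 1 ≤ (S t).card) := by
  have hpow : ∀ {a b : ℕ}, a ≤ b → 2 ^ a ≤ 2 ^ b := fun h =>
    Nat.pow_le_pow_right (by norm_num) h
  refine ⟨fun j => 2 ^ (j : ℕ), fun k j => if m + k ≤ (j : ℕ) then 2 ^ ((j : ℕ) + 1) else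
    if (k : ℕ) = 0 then 2 ^ (j : ℕ) else 2 ^ (m + k - 1), fun j => Nat.one_le_two_pow,
    ?_, ?_, ?_, ?_⟩
  · intro k i j hij
    rw [Fin.le_def] at hij
    dsimp only
    split_ifs <;> first | omega | exact hpow (by omega)
  · intro k j
    dsimp only
    split_ifs <;> exact hpow (by omega)
  · intro k
    by_cases hk : (k : ℕ) = 0
    · simpa [hk] using feasiblePre_initial_tight (n := n) m (by omega)
    · have hlt : m + k - 1 < n := by omega
      have hiff : ∀ j : Fin n, (⟨m + k - 1, hlt⟩ : Fin n) < j ↔ m + k ≤ (j : ℕ) := by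
        intro j
        rw [Fin.lt_def]
        dsimp only
        omega
      simpa only [hk, if_false, hiff] using feasiblePre_single_tight ⟨m + k - 1, hlt⟩ m hm
  · intro S _ hS
    have htight : ∀ (j : Fin n) (k : Fin (n - m)), (if m + k ≤ (j : ℕ) then 2 ^ ((j : ℕ) + 1) else
        if (k : ℕ) = 0 then 2 ^ (j : ℕ) else 2 ^ (m + k - 1)) = 2 ^ (j : ℕ) → j ∈ S 0 := by
      intro j k hjk
      have h := hS j k
      dsimp only at h
      rw [hjk] at h
      exact Finset.filter_card_eq (h.trans (Finset.card_range _).symm) 0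
        (Finset.mem_range.2 (by positivity))
    have hmem : ∀ j : Fin n, (j : ℕ) < n - 1 → j ∈ S 0 := by
      intro j hj
      by_cases h : (j : ℕ) < m
      · refine htight j ⟨0, by omega⟩ ?_
        simp [h]
      · refine htight j ⟨j + 1 - m, by omega⟩ ?_
        dsimp only
        rw [if_neg (by omega), if_neg (by omega)]
        congr 1
        omega
    refine ⟨0, ?_⟩
    have hsub : Finset.univ.erase (⟨n - 1, by omega⟩ : Fin n) ⊆ S 0 := by
      intro j hj
      have := Fin.val_ne_of_ne (Finset.ne_of_mem_erase hj)
      dsimp only at this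
      exact hmem j (by omega)
    simpa using Finset.card_le_card hsub
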